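/- arXiv:2306.10779 — 3 statements merged into one kernel-verified Lean document; each statement's English description precedes it below -/
import Mathlib

section
/- Fix m ∈ {1,…,p} and suppose the m-th column of Λ is zero, i.e. [Λ]_{nm} = 0 for all n = 1,…,p. Assume that for each j the map u ↦ g(x_j, β, u) is continuously differentiable on ℝ^p and that, on a neighbourhood of Λ, the partial derivatives of the integrand with respect to the entries [Λ]_{nm} are dominated by a function of ξ that is integrable with respect to the standard Gaussian measure on ℝ^p. Then for every n ∈ {1,…,p} and every y ∈ ℝ^J, the partial derivative ∂f(y;θ)/∂[Λ]_{nm} equals 0. Consequently the gradient of log f(y;θ) with respect to the entries of the m-th column of Λ vanishes for every y, and in particular this gradient has zero covariance matrix under any probability distribution for y. -/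
open MeasureTheory

/-- The standard Gaussian measure on `ℝ^p`, defined as Lebesgue measure weighted by the
standard Gaussian density. -/
noncomputable def stdGaussianPi (p : ℕ) : Measure (Fin p → ℝ) :=
  volume.withDensity fun ξ =>
    ENNReal.ofReal ((2 * Real.pi) ^ (-(p : ℝ) / 2) * Real.exp (-(∑ k, (ξ k) ^ 2) / 2))

/-- The conditional Gaussian density of the observation `y ∈ ℝ^J` given the random effect
`ξ ∈ ℝ^p`, for noise variance `σ²`, response functions `G j = g(x_j, β, ·)` and scaling
matrix `L = Λ`. -/
noncomputable def condDensity (J p : ℕ) (σ2 : ℝ) (G : Fin J → (Fin p → ℝ) → ℝ)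
    (L : Matrix (Fin p) (Fin p) ℝ) (y : Fin J → ℝ) (ξ : Fin p → ℝ) : ℝ :=
  (2 * Real.pi * σ2) ^ (-(J : ℝ) / 2) *
    Real.exp (-(∑ j, (y j - G j (L.mulVec ξ)) ^ 2) / (2 * σ2))

/-- The marginal density of an observation in the nonlinear mixed-effects model: the
conditional density given the random effect, integrated against the standard Gaussian
distribution of the random effect. -/
noncomputable def margDensity (J p : ℕ) (σ2 : ℝ) (G : Fin J → (Fin p → ℝ) → ℝ)
    (L : Matrix (Fin p) (Fin p) ℝ) (y : Fin J → ℝ) : ℝ :=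
  ∫ ξ, condDensity J p σ2 G L y ξ ∂(stdGaussianPi p)

/-- The matrix supported on the `m`-th column, with that column equal to `v`. Adding
`colMat p m v` to `Λ` perturbs exactly the entries `[Λ]_{n m}`, `n = 1, …, p`. -/
def colMat (p : ℕ) (m : Fin p) (v : Fin p → ℝ) : Matrix (Fin p) (Fin p) ℝ :=
  Matrix.of fun i j => if j = m then v i else 0


noncomputable def condPhi (J p : ℕ) (σ2 : ℝ) (G : Fin J → (Fin p → ℝ) → ℝ)
    (y : Fin J → ℝ) (u : Fin p → ℝ) : ℝ :=
  (2 * Real.pi * σ2) ^ (-(J : ℝ) / 2) *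
    Real.exp (-(∑ j, (y j - G j u) ^ 2) / (2 * σ2))

lemma condPhi_contDiff (J p : ℕ) (σ2 : ℝ) (G : Fin J → (Fin p → ℝ) → ℝ)
    (hG : ∀ j, ContDiff ℝ 1 (G j)) (y : Fin J → ℝ) : ContDiff ℝ 1 (condPhi J p σ2 G y) := by
  unfold condPhi
  refine contDiff_const.mul (ContDiff.exp (ContDiff.div_const (ContDiff.neg ?_) _))
  exact ContDiff.sum fun j _ => (contDiff_const.sub (hG j)).pow 2

lemma mulVec_colMat (p : ℕ) (L : Matrix (Fin p) (Fin p) ℝ) (m : Fin p) (v ξ : Fin p → ℝ) :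
    (L + colMat p m v).mulVec ξ = L.mulVec ξ + ξ m • v := by
  rw [Matrix.add_mulVec]
  congr 1
  ext i
  simp [colMat, Matrix.mulVec, dotProduct, mul_comm]

lemma condDensity_eq (J p : ℕ) (σ2 : ℝ) (G : Fin J → (Fin p → ℝ) → ℝ)
    (L : Matrix (Fin p) (Fin p) ℝ) (m : Fin p) (y : Fin J → ℝ) (v ξ : Fin p → ℝ) :
    condDensity J p σ2 G (L + colMat p m v) y ξ
      = condPhi J p σ2 G y (L.mulVec ξ + ξ m • v) := by
  unfold condDensity condPhi
  rw [mulVec_colMat]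

/-- Sign flip of the `m`-th coordinate. -/
noncomputable def flipE (p : ℕ) (m : Fin p) : (Fin p → ℝ) ≃ᵐ (Fin p → ℝ) :=
  MeasurableEquiv.piCongrRight fun i =>
    if i = m then MeasurableEquiv.neg ℝ else MeasurableEquiv.refl ℝ

lemma flipE_apply (p : ℕ) (m : Fin p) (ξ : Fin p → ℝ) (i : Fin p) :
    flipE p m ξ i = if i = m then - ξ i else ξ i := by
  show (if i = m then MeasurableEquiv.neg ℝ else MeasurableEquiv.refl ℝ) (ξ i) = _
  split_ifs <;> rfl

lemma flipE_mp (p : ℕ) (m : Fin p) : MeasurePreserving (flipE p m) volume volume := by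
  refine volume_preserving_pi
    (f := fun i => ⇑(if i = m then MeasurableEquiv.neg ℝ else MeasurableEquiv.refl ℝ)) ?_
  intro i
  split_ifs
  · exact Measure.measurePreserving_neg volume
  · exact MeasurePreserving.id volume

lemma integral_odd (p : ℕ) (m : Fin p) {E : Type*} [NormedAddCommGroup E] [NormedSpace ℝ E]
    (H : (Fin p → ℝ) → E) (hH : ∀ ξ, H (flipE p m ξ) = - H ξ) :
    ∫ ξ, H ξ ∂(stdGaussianPi p) = 0 := by
  unfold stdGaussianPi
  rw [integral_withDensity_eq_integral_toReal_smul (by fun_prop)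
    (Filter.Eventually.of_forall fun _ => ENNReal.ofReal_lt_top)]
  set K : (Fin p → ℝ) → E := fun ξ => (ENNReal.ofReal ((2 * Real.pi) ^ (-(p : ℝ) / 2) *
    Real.exp (-(∑ k, (ξ k) ^ 2) / 2))).toReal • H ξ with hK
  have h1 : ∫ ξ, K (flipE p m ξ) = ∫ ξ, K ξ := (flipE_mp p m).integral_comp' K
  have h2 : ∀ ξ, K (flipE p m ξ) = - K ξ := by
    intro ξ
    have : ∑ k, (flipE p m ξ k) ^ 2 = ∑ k, (ξ k) ^ 2 := by
      refine Finset.sum_congr rfl fun k _ => ?_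
      rw [flipE_apply]
      split_ifs <;> ring
    simp only [hK]
    rw [this, hH, smul_neg]
  simp_rw [h2] at h1
  rw [integral_neg] at h1
  have h4 : (2 : ℝ) • ∫ ξ, K ξ = 0 := by
    rw [two_smul]
    nth_rewrite 1 [← h1]
    exact neg_add_cancel _
  exact (smul_eq_zero.mp h4).resolve_left two_ne_zero

lemma mulVec_flip (p : ℕ) (L : Matrix (Fin p) (Fin p) ℝ) (m : Fin p) (hcol : ∀ n, L n m = 0)
    (ξ : Fin p → ℝ) : L.mulVec (flipE p m ξ) = L.mulVec ξ := by
  ext i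
  simp only [Matrix.mulVec, dotProduct]
  refine Finset.sum_congr rfl fun k _ => ?_
  rw [flipE_apply]
  split_ifs with h
  · subst h
    simp [hcol]
  · rfl

lemma hasFDerivAt_cond (J p : ℕ) (σ2 : ℝ) (G : Fin J → (Fin p → ℝ) → ℝ)
    (hG : ∀ j, ContDiff ℝ 1 (G j)) 
    (L : Matrix (Fin p) (Fin p) ℝ) (m : Fin p) (y : Fin J → ℝ) (v ξ : Fin p → ℝ) :
    HasFDerivAt (fun w => condDensity J p σ2 G (L + colMat p m w) y ξ)
      (ξ m • fderiv ℝ (condPhi J p σ2 G y) (L.mulVec ξ + ξ m • v)) v := by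
  simp_rw [condDensity_eq]
  have h1 : HasFDerivAt (condPhi J p σ2 G y)
      (fderiv ℝ (condPhi J p σ2 G y) (L.mulVec ξ + ξ m • v)) (L.mulVec ξ + ξ m • v) :=
    ((condPhi_contDiff J p σ2 G hG y).differentiable (by norm_num) _).hasFDerivAt
  have h2 : HasFDerivAt (fun w : Fin p → ℝ => L.mulVec ξ + ξ m • w)
      (ξ m • ContinuousLinearMap.id ℝ (Fin p → ℝ)) v :=
    ((hasFDerivAt_id v).const_smul (ξ m)).const_add _
  have h3 := h1.comp v h2
  have h4 : ξ m • fderiv ℝ (condPhi J p σ2 G y) (L.mulVec ξ + ξ m • v) =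
      (fderiv ℝ (condPhi J p σ2 G y) (L.mulVec ξ + ξ m • v)).comp
        (ξ m • ContinuousLinearMap.id ℝ (Fin p → ℝ)) :=
    ContinuousLinearMap.ext fun w =>
      (map_smul (fderiv ℝ (condPhi J p σ2 G y) (L.mulVec ξ + ξ m • v)) (ξ m) w).symm
  rw [h4]
  exact h3

lemma marg_deriv (p J : ℕ) (σ2 : ℝ)
    (G : Fin J → (Fin p → ℝ) → ℝ) (hG : ∀ j, ContDiff ℝ 1 (G j))
    (L : Matrix (Fin p) (Fin p) ℝ) (m : Fin p) (hcol : ∀ n, L n m = 0)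
    (hdom : ∃ ε : ℝ, 0 < ε ∧ ∃ h : (Fin p → ℝ) → ℝ,
      Integrable h (stdGaussianPi p) ∧
      ∀ v : Fin p → ℝ, ‖v‖ < ε → ∀ (ξ : Fin p → ℝ) (y : Fin J → ℝ),
        ‖fderiv ℝ (fun w => condDensity J p σ2 G (L + colMat p m w) y ξ) v‖ ≤ h ξ)
    (hpos : ∀ y : Fin J → ℝ, 0 < margDensity J p σ2 G L y) (y : Fin J → ℝ) :
    HasFDerivAt (fun v => margDensity J p σ2 G (L + colMat p m v) y)
        (0 : (Fin p → ℝ) →L[ℝ] ℝ) 0 := by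
  obtain ⟨ε, hε, h, hint, hb⟩ := hdom
  have hmv : Continuous fun ξ : Fin p → ℝ => L.mulVec ξ :=
    Continuous.matrix_mulVec continuous_const continuous_id
  have hΦ := condPhi_contDiff J p σ2 G hG y
  have hz : L + colMat p m 0 = L := by
    ext i j
    simp [colMat]
  have key := hasFDerivAt_integral_of_dominated_of_fderiv_le (𝕜 := ℝ) (μ := stdGaussianPi p)
    (F := fun v ξ => condDensity J p σ2 G (L + colMat p m v) y ξ)
    (F' := fun v ξ => ξ m • fderiv ℝ (condPhi J p σ2 G y) (L.mulVec ξ + ξ m • v))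
    (x₀ := 0) (bound := h) (s := Metric.ball 0 ε) (Metric.ball_mem_nhds _ hε)
    (Filter.Eventually.of_forall fun v => by
      simp_rw [condDensity_eq]
      have := hΦ.continuous
      exact Continuous.aestronglyMeasurable (by fun_prop))
    (by
      by_contra hni
      have h0 := hpos y
      unfold margDensity at h0
      simp only [hz] at hni
      rw [integral_undef hni] at h0
      exact lt_irrefl _ h0)
    (by
      have := hΦ.continuous_fderiv (by norm_num)
      exact Continuous.aestronglyMeasurable (by fun_prop))
    (Filter.Eventually.of_forall fun ξ v hv => by
      rw [← (hasFDerivAt_cond J p σ2 G hG L m y v ξ).fderiv]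
      exact hb v (by simpa using hv) ξ y)
    hint
    (Filter.Eventually.of_forall fun ξ v _ => hasFDerivAt_cond J p σ2 G hG L m y v ξ)
  rw [integral_odd p m] at key
  · exact key
  · intro ξ
    simp only [mulVec_flip p L m hcol, flipE_apply, if_true, smul_zero, add_zero]
    exact neg_smul _ _

/-!
Vanishing of the score with respect to the entries of a null column of `Λ`: if the `m`-th
column of `Λ` is zero, `g(x_j, β, ·)` is `C¹` and the partial derivatives of the integrand
with respect to the entries of the `m`-th column are dominated near `Λ` by a Gaussian-
integrable function of `ξ`, then all partial derivatives `∂f(y;θ)/∂[Λ]_{nm}` vanish (the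
full derivative of `v ↦ f(y; Λ + colMat v)` at `0` is the zero map), hence so does the
gradient of `log f(y;θ)` in these directions, and this gradient has zero covariance matrix
under any probability distribution for `y`.
-/

theorem stmt_0 (p J : ℕ) (σ2 : ℝ) (hσ2 : 0 < σ2)
    (G : Fin J → (Fin p → ℝ) → ℝ) (hG : ∀ j, ContDiff ℝ 1 (G j))
    (L : Matrix (Fin p) (Fin p) ℝ) (m : Fin p) (hcol : ∀ n, L n m = 0)
    (hdom : ∃ ε : ℝ, 0 < ε ∧ ∃ h : (Fin p → ℝ) → ℝ,
      Integrable h (stdGaussianPi p) ∧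
      ∀ v : Fin p → ℝ, ‖v‖ < ε → ∀ (ξ : Fin p → ℝ) (y : Fin J → ℝ),
        ‖fderiv ℝ (fun w => condDensity J p σ2 G (L + colMat p m w) y ξ) v‖ ≤ h ξ)
    (hpos : ∀ y : Fin J → ℝ, 0 < margDensity J p σ2 G L y) :
    ∀ y : Fin J → ℝ,
      HasFDerivAt (fun v => margDensity J p σ2 G (L + colMat p m v) y)
        (0 : (Fin p → ℝ) →L[ℝ] ℝ) 0 ∧
      HasFDerivAt (fun v => Real.log (margDensity J p σ2 G (L + colMat p m v) y))
        (0 : (Fin p → ℝ) →L[ℝ] ℝ) 0 ∧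
      ∀ (ν : Measure (Fin J → ℝ)), IsProbabilityMeasure ν → ∀ n₁ n₂ : Fin p,
        (∫ y', (fderiv ℝ (fun v => Real.log (margDensity J p σ2 G (L + colMat p m v) y')) 0
              (Pi.single n₁ 1)) *
            (fderiv ℝ (fun v => Real.log (margDensity J p σ2 G (L + colMat p m v) y')) 0
              (Pi.single n₂ 1)) ∂ν) -
          (∫ y', fderiv ℝ (fun v => Real.log (margDensity J p σ2 G (L + colMat p m v) y')) 0
              (Pi.single n₁ 1) ∂ν) *
          (∫ y', fderiv ℝ (fun v => Real.log (margDensity J p σ2 G (L + colMat p m v) y')) 0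
              (Pi.single n₂ 1) ∂ν) = 0 := by
  have hm := marg_deriv p J σ2 G hG L m hcol hdom hpos
  have hz : L + colMat p m 0 = L := by
    ext i j
    simp [colMat]
  have hl : ∀ y, HasFDerivAt (fun v => Real.log (margDensity J p σ2 G (L + colMat p m v) y))
        (0 : (Fin p → ℝ) →L[ℝ] ℝ) 0 := by
    intro y
    have := (hm y).log (by rw [hz]; exact (hpos y).ne')
    simpa using this
  intro y
  refine ⟨hm y, hl y, ?_⟩
  intro ν _ n₁ n₂
  simp [fun y' => (hl y').fderiv]
end

section
/- Let Θ ⊂ ℝ^q be compact and convex, μ a σ-finite measure on ℝ^J, and (f(·;θ))_{θ∈Θ} a jointly measurable, identifiable family of strictly positive probability densities with respect to μ, continuously differentiable in θ, satisfying sup_{θ'∈Θ} E_{θ'}[sup_{θ∈Θ} (log f(y;θ))²] < ∞ and sup_{θ'∈Θ} E_{θ'}[sup_{θ∈Θ} ‖∇_θ log f(y;θ)‖²] < ∞, where E_{θ'} denotes expectation when y has density f(·;θ'). On a probability space (Ω, 𝔉, P), let θ*_N : Ω → Θ be random parameters converging to θ₀ ∈ Θ in probability, and for each N and ω let P*_{N,ω}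 = (f(·;θ*_N(ω))·μ)^{⊗N} be the law of the bootstrap sample y*_1,…,y*_N. Then for any measurable selection θ̂^B_N of maximizers of θ ↦ Σ_{i=1}^N log f(y*_i;θ) over Θ (or over any compact Θ₀ ⊆ Θ containing θ₀), and for all ε > 0 and η > 0, P({ω : P*_{N,ω}(‖θ̂^B_N − θ₀‖ > ε) > η}) → 0 as N → ∞. -/
open MeasureTheory Filter

/-- The probability measure with density `f(·;θ)` with respect to `μ`. -/
noncomputable def densMeasure {E : Type*} [MeasurableSpace E] (μ : Measure E) {q : ℕ}
    (f : E → EuclideanSpace ℝ (Fin q) → ℝ) (θ : EuclideanSpace ℝ (Fin q)) : Measure E :=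
  μ.withDensity fun y => ENNReal.ofReal (f y θ)

/-- The law `P*_{N} = (f(·;θ)·μ)^{⊗N}` of an i.i.d. bootstrap sample of size `N` drawn
from the density `f(·;θ)`. -/
noncomputable def bootLaw {E : Type*} [MeasurableSpace E] (μ : Measure E) {q : ℕ}
    (f : E → EuclideanSpace ℝ (Fin q) → ℝ)
    [∀ θ, SigmaFinite (densMeasure μ f θ)]
    (N : ℕ) (θ : EuclideanSpace ℝ (Fin q)) : Measure (Fin N → E) :=
  Measure.pi fun _ : Fin N => densMeasure μ f θ

/-!
Consistency of the bootstrap maximum likelihood estimator: if the bootstrap parameter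
`θ*_N` (a measurable function of the data) converges to `θ₀` in probability and
bootstrap samples of size `N` are drawn i.i.d. from the density `f(·;θ*_N)`, then any
measurable selection of maximizers of the bootstrap log-likelihood over a compact
`Θ₀ ⊆ Θ` containing `θ₀` (in particular over `Θ` itself) converges to `θ₀` in
conditional probability: for all `ε, η > 0`, the probability that the conditional
bootstrap probability of `{‖θ̂^B_N − θ₀‖ > ε}` exceeds `η` tends to zero.
-/


namespace BootAux

variable {E : Type*} [MeasurableSpace E]

theorem dens_integrable_iff (μ : Measure E) {p : E → ℝ} (hp : Measurable p) (hp0 : ∀ z, 0 ≤ p z)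
    {h : E → ℝ} :
    Integrable h (μ.withDensity fun z => ENNReal.ofReal (p z)) ↔
      Integrable (fun z => p z * h z) μ := by
  have := integrable_withDensity_iff_integrable_coe_smul (μ := μ)
    (f := fun z => (p z).toNNReal) hp.real_toNNReal (g := h)
  simpa [Real.coe_toNNReal _ (hp0 _), ENNReal.ofReal] using this

theorem dens_integral (μ : Measure E) {p : E → ℝ} (hp : Measurable p) (hp0 : ∀ z, 0 ≤ p z)
    (h : E → ℝ) :
    ∫ z, h z ∂(μ.withDensity fun z => ENNReal.ofReal (p z)) = ∫ z, p z * h z ∂μ := by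
  have := integral_withDensity_eq_integral_smul (μ := μ)
    (f := fun z => (p z).toNNReal) hp.real_toNNReal h
  simpa [ENNReal.ofReal, NNReal.smul_def, Real.coe_toNNReal _ (hp0 _)] using this

theorem dens_prob (μ : Measure E) {p : E → ℝ} (hp0 : ∀ z, 0 ≤ p z)
    (h1 : ∫ z, p z ∂μ = 1) :
    IsProbabilityMeasure (μ.withDensity fun z => ENNReal.ofReal (p z)) := by
  have hi : Integrable p μ := by
    by_contra hc
    rw [integral_undef hc] at h1
    exact zero_ne_one h1
  constructor
  rw [withDensity_apply _ MeasurableSet.univ, Measure.restrict_univ,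
    ← ofReal_integral_eq_lintegral_ofReal hi (ae_of_all _ hp0), h1, ENNReal.ofReal_one]

/-- Chebyshev bound for i.i.d. sums. -/
theorem cheb (ν : Measure E) [IsProbabilityMeasure ν] (h : E → ℝ)
    (hL : MemLp h 2 ν) (M δ : ℝ) (hδ : 0 < δ) (hM : ∫ z, h z ^ 2 ∂ν ≤ M)
    (hm : ∫ z, h z ∂ν ≤ -δ) (N : ℕ) (hN : 0 < N) :
    Measure.pi (fun _ : Fin N => ν) {ys | 0 ≤ ∑ i, h (ys i)} ≤
      ENNReal.ofReal (M / (N * δ ^ 2)) := by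
  set π := Measure.pi (fun _ : Fin N => ν) with hπ
  set S : (Fin N → E) → ℝ := ∑ i : Fin N, fun ys => h (ys i) with hS
  have hmp : ∀ i : Fin N, MeasurePreserving (fun ys : Fin N → E => ys i) π ν :=
    fun i => measurePreserving_eval (fun _ : Fin N => ν) i
  have hLi : ∀ i : Fin N, MemLp (fun ys : Fin N → E => h (ys i)) 2 π :=
    fun i => hL.comp_measurePreserving (hmp i)
  have hSL : MemLp S 2 π := memLp_finsetSum' _ fun i _ => hLi i
  have hNr : (0 : ℝ) < N := by exact_mod_cast hN
  have hvar : ProbabilityTheory.variance S π ≤ N * M := by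
    rw [hS, hπ, ProbabilityTheory.variance_sum_pi (X := fun _ : Fin N => h) (fun _ => hL)]
    simp only [Finset.sum_const, Finset.card_univ, Fintype.card_fin, nsmul_eq_mul]
    gcongr
    exact (ProbabilityTheory.variance_le_expectation_sq hL.1).trans hM
  have hmean : ∫ ys, S ys ∂π = N * ∫ z, h z ∂ν := by
    have : ∀ i : Fin N, ∫ ys, h (ys i) ∂π = ∫ z, h z ∂ν := by
      intro i
      rw [← (hmp i).map_eq, integral_map (hmp i).measurable.aemeasurable]
      rw [(hmp i).map_eq]; exact hL.1
    simp only [hS, Finset.sum_apply]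
    rw [integral_finsetSum _ fun i _ => (hLi i).integrable (by norm_num)]
    simp [this]
  have hc : 0 < N * δ := by positivity
  have key := ProbabilityTheory.meas_ge_le_variance_div_sq hSL hc
  refine (measure_mono ?_).trans (key.trans (ENNReal.ofReal_le_ofReal ?_))
  · intro ys hys
    simp only [Set.mem_ofPred_eq] at hys ⊢
    have hS' : S ys = ∑ i, h (ys i) := by simp [hS]
    rw [hmean, hS']
    refine le_trans ?_ (le_abs_self _)
    nlinarith
  · calc _ ≤ N * M / (N * δ) ^ 2 := by gcongr
      _ = _ := by field_simp

/-- Scheffe. -/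
theorem scheffe {X : Type*} [MetricSpace X] (μ : Measure E) (F : X → E → ℝ)
    (hpos : ∀ x z, 0 < F x z) (hint : ∀ x, Integrable (F x) μ)
    (h1 : ∀ x, ∫ z, F x z ∂μ = 1) (hcont : ∀ z, Continuous fun x => F x z) (x₀ : X) :
    Tendsto (fun x => ∫ z, |F x z - F x₀ z| ∂μ) (nhds x₀) (nhds 0) := by
  have hmax : ∀ x, Integrable (fun z => max (F x₀ z - F x z) 0) μ :=
    fun x => ((hint x₀).sub (hint x)).pos_part
  have h2 : Tendsto (fun x => ∫ z, max (F x₀ z - F x z) 0 ∂μ) (nhds x₀) (nhds (∫ z, (0:ℝ) ∂μ)) := by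
    refine tendsto_integral_filter_of_dominated_convergence (F x₀)
      (Eventually.of_forall fun x => (hmax x).1) (Eventually.of_forall fun x => ae_of_all _ ?_)
      (hint x₀) (ae_of_all _ ?_)
    · intro z
      have := hpos x z; have := hpos x₀ z
      rw [Real.norm_eq_abs, abs_of_nonneg (le_max_right _ _)]
      apply max_le <;> linarith
    · intro z
      have : Continuous fun x => max (F x₀ z - F x z) 0 := by
        have := hcont z; fun_prop
      simpa using this.tendsto x₀
  have : ∀ x, ∫ z, |F x z - F x₀ z| ∂μ = 2 * ∫ z, max (F x₀ z - F x z) 0 ∂μ := by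
    intro x
    have e : ∀ z, |F x z - F x₀ z| = 2 * max (F x₀ z - F x z) 0 + (F x z - F x₀ z) := by
      intro z
      rcases le_total (F x z) (F x₀ z) with h | h
      · rw [abs_of_nonpos (by linarith), max_eq_left (by linarith)]; ring
      · rw [abs_of_nonneg (by linarith), max_eq_right (by linarith)]; ring
    simp_rw [e]
    have i1 : Integrable (fun z => F x z - F x₀ z) μ := (hint x).sub (hint x₀)
    rw [integral_add ((hmax x).const_mul 2) i1, integral_const_mul,
      integral_sub (hint x) (hint x₀), h1, h1]
    ring
  simp_rw [this]
  simpa using h2.const_mul 2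

theorem mean_ev {X : Type*} [MetricSpace X] (μ : Measure E) (F : X → E → ℝ)
    (hpos : ∀ x z, 0 < F x z) (hint : ∀ x, Integrable (F x) μ)
    (h1 : ∀ x, ∫ z, F x z ∂μ = 1) (hcont : ∀ z, Continuous fun x => F x z) (x₀ : X)
    (h : E → ℝ) (M : ℝ)
    (hi1 : ∀ x, Integrable (fun z => F x z * h z) μ)
    (hi2 : ∀ x, Integrable (fun z => F x z * h z ^ 2) μ)
    (hM : ∀ x, ∫ z, F x z * h z ^ 2 ∂μ ≤ M) (γ : ℝ) (hγ : 0 < γ) :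
    ∀ᶠ x in nhds x₀, ∫ z, F x z * h z ∂μ ≤ ∫ z, F x₀ z * h z ∂μ + γ := by
  have hM0 : 0 ≤ M := le_trans (integral_nonneg fun z =>
    mul_nonneg (hpos x₀ z).le (sq_nonneg _)) (hM x₀)
  set K : ℝ := (4 * M + 1) / γ with hK
  have hK0 : 0 < K := by positivity
  have hS := scheffe μ F hpos hint h1 hcont x₀
  have hev : ∀ᶠ x in nhds x₀, ∫ z, |F x z - F x₀ z| ∂μ < γ / (2 * K) :=
    hS.eventually_lt_const (by positivity)
  filter_upwards [hev] with x hx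
  have hle : ∫ z, (F x z * h z - F x₀ z * h z) ∂μ ≤
      ∫ z, (K * |F x z - F x₀ z| + K⁻¹ * (F x z * h z ^ 2 + F x₀ z * h z ^ 2)) ∂μ := by
    refine integral_mono ((hi1 x).sub (hi1 x₀))
      (((((hint x).sub (hint x₀)).abs).const_mul K).add (((hi2 x).add (hi2 x₀)).const_mul _)) ?_
    intro z
    have a1 : |h z| ≤ K + K⁻¹ * h z ^ 2 := by
      rw [← sq_abs]
      have : 0 ≤ K⁻¹ * ((|h z| - K) ^ 2 + |h z| * K) := by positivity
      have e : K⁻¹ * ((|h z| - K) ^ 2 + |h z| * K) = K + K⁻¹ * |h z| ^ 2 - |h z| := by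
        field_simp; ring
      linarith
    have a2 : |F x z - F x₀ z| ≤ F x z + F x₀ z := by
      have := hpos x z; have := hpos x₀ z
      rw [abs_le]; constructor <;> linarith
    calc F x z * h z - F x₀ z * h z = (F x z - F x₀ z) * h z := by ring
      _ ≤ |F x z - F x₀ z| * |h z| := by rw [← abs_mul]; exact le_abs_self _
      _ ≤ |F x z - F x₀ z| * (K + K⁻¹ * h z ^ 2) := by gcongr
      _ = K * |F x z - F x₀ z| + |F x z - F x₀ z| * (K⁻¹ * h z ^ 2) := by ring
      _ ≤ K * |F x z - F x₀ z| + (F x z + F x₀ z) * (K⁻¹ * h z ^ 2) := by gcongr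
      _ = _ := by ring
  have i1 : Integrable (fun z => K * |F x z - F x₀ z|) μ :=
    (((hint x).sub (hint x₀)).abs).const_mul K
  have i2 : Integrable (fun z => K⁻¹ * (F x z * h z ^ 2 + F x₀ z * h z ^ 2)) μ :=
    ((hi2 x).add (hi2 x₀)).const_mul _
  rw [integral_sub (hi1 x) (hi1 x₀), integral_add i1 i2,
    integral_const_mul, integral_const_mul, integral_add (hi2 x) (hi2 x₀)] at hle
  have b1 : K * ∫ z, |F x z - F x₀ z| ∂μ ≤ γ / 2 := by
    calc _ ≤ K * (γ / (2 * K)) := by gcongr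
      _ = _ := by field_simp
  have b2 : K⁻¹ * (∫ z, F x z * h z ^ 2 ∂μ + ∫ z, F x₀ z * h z ^ 2 ∂μ) ≤ γ / 2 := by
    calc _ ≤ K⁻¹ * (M + M) := by gcongr <;> apply hM
      _ ≤ γ / 2 := by
        rw [hK, inv_div, div_mul_eq_mul_div, div_le_iff₀ (by positivity)]
        nlinarith
  linarith

theorem kl_neg (μ : Measure E) (p p₀ : E → ℝ) 
    (hpos : ∀ z, 0 < p z) (hpos₀ : ∀ z, 0 < p₀ z) (hint : Integrable p μ) (hint₀ : Integrable p₀ μ)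
    (h1 : ∫ z, p z ∂μ = 1) (h1₀ : ∫ z, p₀ z ∂μ = 1)
    (hi : Integrable (fun z => p₀ z * (Real.log (p z) - Real.log (p₀ z))) μ)
    (hne : ¬ p =ᵐ[μ] p₀) :
    ∫ z, p₀ z * (Real.log (p z) - Real.log (p₀ z)) ∂μ < 0 := by
  by_contra! hc
  have e : ∀ z, Real.log (p z) - Real.log (p₀ z) = Real.log (p z / p₀ z) := fun z =>
    (Real.log_div (hpos z).ne' (hpos₀ z).ne').symm
  have hnn : ∀ z, 0 ≤ (p z - p₀ z) - p₀ z * (Real.log (p z) - Real.log (p₀ z)) := by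
    intro z
    rw [e]
    have := Real.log_le_sub_one_of_pos (div_pos (hpos z) (hpos₀ z))
    have h2 := mul_le_mul_of_nonneg_left this (hpos₀ z).le
    have : p₀ z * (p z / p₀ z - 1) = p z - p₀ z := by
      have := hpos₀ z; field_simp
    linarith
  have hI : Integrable (fun z => (p z - p₀ z) - p₀ z * (Real.log (p z) - Real.log (p₀ z))) μ :=
    (hint.sub hint₀).sub hi
  have hz : ∫ z, ((p z - p₀ z) - p₀ z * (Real.log (p z) - Real.log (p₀ z))) ∂μ = 0 := by
    apply le_antisymm _ (integral_nonneg hnn)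
    have i1 : Integrable (fun z => p z - p₀ z) μ := hint.sub hint₀
    rw [integral_sub i1 hi, integral_sub hint hint₀, h1, h1₀]
    linarith
  rw [integral_eq_zero_iff_of_nonneg hnn hI] at hz
  apply hne
  filter_upwards [hz] with z hz
  simp only [Pi.zero_apply] at hz
  by_contra hne
  rw [e] at hz
  have hr : p z / p₀ z ≠ 1 := by
    rw [Ne, div_eq_one_iff_eq (hpos₀ z).ne']; exact hne
  have := Real.log_lt_sub_one_of_pos (div_pos (hpos z) (hpos₀ z)) hr
  have h2 := mul_lt_mul_of_pos_left this (hpos₀ z)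
  have : p₀ z * (p z / p₀ z - 1) = p z - p₀ z := by
    have := hpos₀ z; field_simp
  linarith

theorem local_h {X : Type*} [MetricSpace X] [CompactSpace X] (μ : Measure E) (F : X → E → ℝ)
    (hm : ∀ x, Measurable (F x))
    (hpos : ∀ x z, 0 < F x z) (hint : ∀ x, Integrable (F x) μ)
    (h1 : ∀ x, ∫ z, F x z ∂μ = 1) (hcont : ∀ z, Continuous fun x => F x z) (x₀ : X)
    (B : E → ℝ) (hB : ∀ y z, |Real.log (F y z)| ≤ B z)
    (hBi : Integrable (fun z => F x₀ z * B z) μ)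
    (x : X) (hne : ¬ F x =ᵐ[μ] F x₀) :
    ∃ r > 0, ∃ h : E → ℝ, Measurable h ∧
      (∀ y z, dist y x < r → Real.log (F y z) - Real.log (F x₀ z) ≤ h z) ∧
      (∀ z, |h z| ≤ 2 * B z) ∧ ∫ z, F x₀ z * h z ∂μ < 0 := by
  classical
  haveI : Nonempty X := ⟨x⟩
  set L : X → E → ℝ := fun y z => Real.log (F y z) with hL
  have hLm : ∀ y, Measurable (L y) := fun y => (hm y).log
  have hLc : ∀ z, Continuous fun y => L y z := fun z =>
    (hcont z).log fun y => (hpos y z).ne'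
  set e := TopologicalSpace.denseSeq X with he
  have hed : DenseRange e := TopologicalSpace.denseRange_denseSeq X
  set T : ℝ → ℕ → E → ℝ := fun r n z => if dist (e n) x < r then L (e n) z else L x z with hT
  set W : ℝ → E → ℝ := fun r z => ⨆ n, T r n z with hW
  have hTB : ∀ r n z, |T r n z| ≤ B z := by
    intro r n z
    simp only [hT]
    split_ifs <;> apply hB
  have hbdd : ∀ r z, BddAbove (Set.range fun n => T r n z) := by
    rintro r z
    refine ⟨B z, ?_⟩
    rintro _ ⟨n, rfl⟩
    exact (le_abs_self _).trans (hTB r n z)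
  have hWm : ∀ r, Measurable (W r) := by
    intro r
    refine Measurable.iSup fun n => ?_
    simp only [hT]
    split_ifs <;> apply hLm
  have hWB : ∀ r z, |W r z| ≤ B z := by
    intro r z
    rw [abs_le]
    constructor
    · exact (abs_le.1 (hTB r 0 z)).1.trans (le_ciSup (hbdd r z) 0)
    · exact ciSup_le fun n => (abs_le.1 (hTB r n z)).2
  have hWge : ∀ r z y, dist y x < r → L y z ≤ W r z := by
    intro r z y hy
    by_contra! hc
    have ho : IsOpen (Metric.ball x r ∩ {y' : X | W r z < L y' z}) :=
      Metric.isOpen_ball.inter (isOpen_lt continuous_const (hLc z))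
    obtain ⟨n, hn⟩ := hed.exists_mem_open ho ⟨y, hy, hc⟩
    have h2 := le_ciSup (hbdd r z) n
    have h3 : T r n z = L (e n) z := by simp only [hT]; rw [if_pos (Metric.mem_ball.1 hn.1)]
    have h4 : W r z < L (e n) z := hn.2
    rw [h3] at h2
    exact absurd h2 (not_le.2 h4)
  have hWlim : ∀ z, Tendsto (fun k : ℕ => W (1 / ((k : ℝ) + 1)) z) atTop (nhds (L x z)) := by
    intro z
    rw [Metric.tendsto_atTop]
    intro a ha
    obtain ⟨d, hd, hd'⟩ := Metric.continuous_iff.1 (hLc z) x (a / 2) (by positivity)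
    obtain ⟨k, hk⟩ := exists_nat_one_div_lt hd
    refine ⟨k, fun m hmk => ?_⟩
    have hmd : 1 / ((m : ℝ) + 1) < d := lt_of_le_of_lt (by gcongr) hk
    have hge : L x z ≤ W (1 / ((m : ℝ) + 1)) z := hWge _ z x (by simp; positivity)
    have hle : W (1 / ((m : ℝ) + 1)) z ≤ L x z + a / 2 := by
      refine ciSup_le fun n => ?_
      simp only [hT]
      split_ifs with hs
      · have := hd' (e n) (hs.trans hmd)
        rw [Real.dist_eq] at this
        have := (abs_lt.1 this).2
        linarith
      · linarith
    rw [Real.dist_eq, abs_of_nonneg (by linarith)]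
    linarith
  have hdom : ∀ r z, |W r z - L x₀ z| ≤ 2 * B z := by
    intro r z
    have a1 := abs_le.1 (hWB r z)
    have a2 := abs_le.1 (hB x₀ z)
    rw [abs_le]
    simp only [hL]
    constructor <;> linarith
  have hmeas : ∀ r, Measurable fun z => F x₀ z * (W r z - L x₀ z) := fun r =>
    (hm x₀).mul ((hWm r).sub (hLm x₀))
  have hlim : Tendsto (fun k : ℕ => ∫ z, F x₀ z * (W (1 / ((k : ℝ) + 1)) z - L x₀ z) ∂μ) atTop
      (nhds (∫ z, F x₀ z * (L x z - L x₀ z) ∂μ)) := by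
    refine tendsto_integral_of_dominated_convergence (fun z => 2 * (F x₀ z * B z))
      (fun k => (hmeas _).aestronglyMeasurable) (hBi.const_mul 2) (fun k => ae_of_all _ fun z => ?_)
      (ae_of_all _ fun z => ((hWlim z).sub_const _).const_mul _)
    rw [Real.norm_eq_abs, abs_mul, abs_of_pos (hpos x₀ z)]
    calc _ ≤ F x₀ z * (2 * B z) := mul_le_mul_of_nonneg_left (hdom _ z) (hpos x₀ z).le
      _ = _ := by ring
  have hi : Integrable (fun z => F x₀ z * (L x z - L x₀ z)) μ := by
    refine (hBi.const_mul 2).mono' ((hm x₀).mul ((hLm x).sub (hLm x₀))).aestronglyMeasurable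
      (ae_of_all _ fun z => ?_)
    rw [Real.norm_eq_abs, abs_mul, abs_of_pos (hpos x₀ z)]
    have a1 := abs_le.1 (hB x z)
    have a2 := abs_le.1 (hB x₀ z)
    have : |L x z - L x₀ z| ≤ 2 * B z := by
      rw [abs_le]
      simp only [hL]
      constructor <;> linarith
    calc _ ≤ F x₀ z * (2 * B z) := mul_le_mul_of_nonneg_left this (hpos x₀ z).le
      _ = _ := by ring
  have hneg := kl_neg μ (F x) (F x₀) (hpos x) (hpos x₀) (hint x) (hint x₀) (h1 x) (h1 x₀) hi hne
  obtain ⟨k, hk⟩ := (hlim.eventually_lt_const hneg).exists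
  refine ⟨1 / ((k : ℝ) + 1), by positivity, fun z => W (1 / ((k : ℝ) + 1)) z - L x₀ z,
    (hWm _).sub (hLm x₀), ?_, hdom _, hk⟩
  intro y z hy
  have := hWge _ z y hy
  simp only [hL] at this ⊢
  linarith

/-- A measurable envelope for the log-likelihood. -/
theorem envelope {X : Type*} [MetricSpace X] [CompactSpace X] [Nonempty X] (F : X → E → ℝ)
    (hm : ∀ x, Measurable (F x))
    (hpos : ∀ x z, 0 < F x z) (hcont : ∀ z, Continuous fun x => F x z) :
    ∃ B : E → ℝ, Measurable B ∧ (∀ y z, |Real.log (F y z)| ≤ B z) ∧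
      ∀ z, B z ^ 2 ≤ ⨆ y, Real.log (F y z) ^ 2 := by
  have hLc : ∀ z, Continuous fun y => |Real.log (F y z)| := fun z =>
    ((hcont z).log fun y => (hpos y z).ne').abs
  have hbdd : ∀ z, BddAbove (Set.range fun y => |Real.log (F y z)|) := fun z =>
    (isCompact_range (hLc z)).bddAbove
  set e := TopologicalSpace.denseSeq X with he
  have hed : DenseRange e := TopologicalSpace.denseRange_denseSeq X
  have hbdd' : ∀ z, BddAbove (Set.range fun n => |Real.log (F (e n) z)|) := fun z =>
    (hbdd z).mono (by rintro _ ⟨n, rfl⟩; exact ⟨e n, rfl⟩)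
  refine ⟨fun z => ⨆ n, |Real.log (F (e n) z)|, ?_, ?_, ?_⟩
  · refine Measurable.iSup fun n => ?_
    have := (hm (e n)).log
    exact this.abs
  · intro y z
    by_contra! hc
    obtain ⟨n, hn⟩ := hed.exists_mem_open (isOpen_lt continuous_const (hLc z)) ⟨y, hc⟩
    exact absurd (le_ciSup (hbdd' z) n) (not_le.2 hn)
  · intro z
    have hb2 : BddAbove (Set.range fun y => Real.log (F y z) ^ 2) :=
      (isCompact_range (((hcont z).log fun y => (hpos y z).ne').pow 2)).bddAbove
    have h0 : 0 ≤ ⨆ y, Real.log (F y z) ^ 2 := Real.iSup_nonneg fun y => sq_nonneg _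
    have hle : (⨆ n, |Real.log (F (e n) z)|) ≤ √(⨆ y, Real.log (F y z) ^ 2) :=
      ciSup_le fun n => Real.abs_le_sqrt (le_ciSup hb2 (e n))
    have hnn : 0 ≤ ⨆ n, |Real.log (F (e n) z)| := Real.iSup_nonneg fun n => abs_nonneg _
    calc _ ≤ √(⨆ y, Real.log (F y z) ^ 2) ^ 2 := by gcongr
      _ = _ := Real.sq_sqrt h0

theorem core {X : Type*} [MetricSpace X] [CompactSpace X] (μ : Measure E) (F : X → E → ℝ)
    [∀ x, SigmaFinite (μ.withDensity fun z => ENNReal.ofReal (F x z))]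
    (hm : ∀ x, Measurable (F x)) (hpos : ∀ x z, 0 < F x z)
    (h1 : ∀ x, ∫ z, F x z ∂μ = 1) (hcont : ∀ z, Continuous fun x => F x z) (x₀ : X) (C : ℝ)
    (hC : ∀ x, ∫⁻ z, ENNReal.ofReal (⨆ y, Real.log (F y z) ^ 2)
      ∂(μ.withDensity fun z => ENNReal.ofReal (F x z)) ≤ ENNReal.ofReal C)
    (hid : ∀ x, F x =ᵐ[μ] F x₀ → x = x₀) (ε : ℝ) (hε : 0 < ε) :
    Tendsto (fun p : ℕ × X => Measure.pi
        (fun _ : Fin p.1 => μ.withDensity fun z => ENNReal.ofReal (F p.2 z))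
        {ys | ∃ y, ε ≤ dist y x₀ ∧ ∑ i, Real.log (F x₀ (ys i)) ≤ ∑ i, Real.log (F y (ys i))})
      (atTop ×ˢ nhds x₀) (nhds 0) := by
  classical
  haveI : Nonempty X := ⟨x₀⟩
  obtain ⟨B, hBm, hB, hB2⟩ := envelope F hm hpos hcont
  have hint : ∀ x, Integrable (F x) μ := by
    intro x
    by_contra hc
    have := h1 x
    rw [integral_undef hc] at this
    exact zero_ne_one this
  have hpr : ∀ x, IsProbabilityMeasure (μ.withDensity fun z => ENNReal.ofReal (F x z)) :=
    fun x => dens_prob μ (fun z => (hpos x z).le) (h1 x)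
  have hBl : ∀ x, ∫⁻ z, ENNReal.ofReal (B z ^ 2)
      ∂(μ.withDensity fun z => ENNReal.ofReal (F x z)) ≤ ENNReal.ofReal C := fun x =>
    (lintegral_mono fun z => ENNReal.ofReal_le_ofReal (hB2 z)).trans (hC x)
  have hB2i : ∀ x, Integrable (fun z => B z ^ 2)
      (μ.withDensity fun z => ENNReal.ofReal (F x z)) := by
    intro x
    refine ⟨(hBm.pow_const 2).aestronglyMeasurable, ?_⟩
    rw [hasFiniteIntegral_iff_ofReal (ae_of_all _ fun z => sq_nonneg _)]
    exact (hBl x).trans_lt ENNReal.ofReal_lt_top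
  have hB2M : ∀ x, ∫ z, B z ^ 2 ∂(μ.withDensity fun z => ENNReal.ofReal (F x z)) ≤ max C 0 := by
    intro x
    rw [integral_eq_lintegral_of_nonneg_ae (ae_of_all _ fun z => sq_nonneg _)
      (hBm.pow_const 2).aestronglyMeasurable]
    have := ENNReal.toReal_mono ENNReal.ofReal_ne_top (hBl x)
    rwa [ENNReal.toReal_ofReal'] at this
  have hBL : ∀ x, MemLp B 2 (μ.withDensity fun z => ENNReal.ofReal (F x z)) := fun x =>
    (memLp_two_iff_integrable_sq hBm.aestronglyMeasurable).2 (hB2i x)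
  have hB0 : ∀ z, 0 ≤ B z := fun z => (abs_nonneg _).trans (hB x₀ z)
  -- the estimate for one ball
  have hloc : ∀ x, ε ≤ dist x x₀ → ∃ r > 0, ∃ h : E → ℝ,
      (∀ y z, dist y x < r → Real.log (F y z) - Real.log (F x₀ z) ≤ h z) ∧
      Tendsto (fun p : ℕ × X => Measure.pi
        (fun _ : Fin p.1 => μ.withDensity fun z => ENNReal.ofReal (F p.2 z))
        {ys | 0 ≤ ∑ i, h (ys i)}) (atTop ×ˢ nhds x₀) (nhds 0) := by
    intro x hx
    have hne : ¬ F x =ᵐ[μ] F x₀ := by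
      intro hc
      rw [hid x hc, dist_self] at hx
      linarith
    obtain ⟨r, hr, h, hhm, hh, hhB, hneg⟩ := local_h μ F hm hpos hint h1 hcont x₀ B hB
      ((dens_integrable_iff μ (hm x₀) fun z => (hpos x₀ z).le).1
        ((hBL x₀).integrable (by norm_num))) x hne
    refine ⟨r, hr, h, hh, ?_⟩
    have hhL : ∀ x, MemLp h 2 (μ.withDensity fun z => ENNReal.ofReal (F x z)) := fun x =>
      ((hBL x).const_mul 2).mono' hhm.aestronglyMeasurable (ae_of_all _ hhB)
    have hhM : ∀ x, ∫ z, h z ^ 2 ∂(μ.withDensity fun z => ENNReal.ofReal (F x z))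
        ≤ 4 * max C 0 := by
      intro x
      calc _ ≤ ∫ z, 4 * B z ^ 2 ∂(μ.withDensity fun z => ENNReal.ofReal (F x z)) := by
            refine integral_mono (hhL x).integrable_sq ((hB2i x).const_mul 4) fun z => ?_
            have := hhB z
            have h2 := sq_le_sq' (by linarith [(abs_nonneg (h z)), hB0 z]) this
            rw [sq_abs] at h2
            simp only
            nlinarith
        _ ≤ _ := by
            rw [integral_const_mul]
            have := hB2M x
            linarith
    set δ : ℝ := - (∫ z, F x₀ z * h z ∂μ) / 2 with hδ
    have hδ0 : 0 < δ := by rw [hδ]; linarith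
    have hev := mean_ev μ F hpos hint h1 hcont x₀ h (4 * max C 0)
      (fun x => (dens_integrable_iff μ (hm x) fun z => (hpos x z).le).1
        ((hhL x).integrable (by norm_num)))
      (fun x => (dens_integrable_iff μ (hm x) fun z => (hpos x z).le).1 (hhL x).integrable_sq)
      (fun x => by
        rw [← dens_integral μ (hm x) (fun z => (hpos x z).le) (fun z => h z ^ 2)]
        exact hhM x) δ hδ0
    have hub : ∀ᶠ p : ℕ × X in atTop ×ˢ nhds x₀, Measure.pi
        (fun _ : Fin p.1 => μ.withDensity fun z => ENNReal.ofReal (F p.2 z))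
        {ys | 0 ≤ ∑ i, h (ys i)} ≤ ENNReal.ofReal (4 * max C 0 / (p.1 * δ ^ 2)) := by
      filter_upwards [(eventually_gt_atTop 0).prod_mk hev] with p hp
      have := hpr p.2
      refine cheb _ h (hhL p.2) _ δ hδ0 (hhM p.2) ?_ p.1 hp.1
      rw [dens_integral μ (hm p.2) (fun z => (hpos p.2 z).le)]
      have := hp.2
      rw [hδ] at this ⊢
      linarith
    have hlim : Tendsto (fun p : ℕ × X => ENNReal.ofReal (4 * max C 0 / (p.1 * δ ^ 2)))
        (atTop ×ˢ nhds x₀) (nhds 0) := by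
      rw [← ENNReal.ofReal_zero]
      refine ENNReal.tendsto_ofReal ?_
      refine Tendsto.div_atTop tendsto_const_nhds ?_
      exact (tendsto_natCast_atTop_atTop.comp tendsto_fst).atTop_mul_const (by positivity)
    exact tendsto_of_tendsto_of_tendsto_of_le_of_le' tendsto_const_nhds hlim
      (Eventually.of_forall fun _ => zero_le) hub
  have hKc : IsCompact {y : X | ε ≤ dist y x₀} :=
    (isClosed_le continuous_const (by fun_prop)).isCompact
  choose! r hr h hh hlim using hloc
  obtain ⟨t, htK, ht⟩ := hKc.elim_nhds_subcover (fun x => Metric.ball x (r x))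
    (fun x hx => Metric.ball_mem_nhds x (hr x hx))
  have hsum := tendsto_finset_sum t (fun x hx => hlim x (htK x hx))
  simp only [Finset.sum_const_zero] at hsum
  refine tendsto_of_tendsto_of_tendsto_of_le_of_le tendsto_const_nhds hsum
    (fun _ => zero_le) fun p => ?_
  refine (measure_mono ?_).trans (measure_biUnion_finset_le t _)
  rintro ys ⟨y, hy, hys⟩
  obtain ⟨x, hxt, hyx⟩ := Set.mem_iUnion₂.1 (ht hy)
  refine Set.mem_iUnion₂.2 ⟨x, hxt, ?_⟩
  have : ∑ i, (Real.log (F y (ys i)) - Real.log (F x₀ (ys i))) ≤ ∑ i, h x (ys i) :=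
    Finset.sum_le_sum fun i _ => hh x (htK x hxt) y (ys i) hyx
  rw [Finset.sum_sub_distrib] at this
  show 0 ≤ ∑ i, h x (ys i)
  linarith

end BootAux

theorem stmt_5 {q J : ℕ}
    (Θ Θ₀ : Set (EuclideanSpace ℝ (Fin q)))
    (hΘcomp : IsCompact Θ) (hΘconv : Convex ℝ Θ)
    (hΘ₀sub : Θ₀ ⊆ Θ) (hΘ₀comp : IsCompact Θ₀)
    (θ₀ : EuclideanSpace ℝ (Fin q)) (hθ₀ : θ₀ ∈ Θ₀)
    (μ : Measure (Fin J → ℝ)) [SigmaFinite μ]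
    (f : (Fin J → ℝ) → EuclideanSpace ℝ (Fin q) → ℝ)
    [∀ θ, SigmaFinite (densMeasure μ f θ)]
    (hmeas : Measurable (Function.uncurry f))
    (hpos : ∀ z θ, θ ∈ Θ → 0 < f z θ)
    (hprob : ∀ θ ∈ Θ, ∫ z, f z θ ∂μ = 1)
    (hdiff : ∀ z, ContDiffOn ℝ 1 (f z) Θ)
    (hmom0 : ∃ C : ℝ, ∀ θ' ∈ Θ,
      ∫⁻ z, ENNReal.ofReal (⨆ θ : Θ, (Real.log (f z θ)) ^ 2)
        ∂(densMeasure μ f θ') ≤ ENNReal.ofReal C)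
    (hmom1 : ∃ C : ℝ, ∀ θ' ∈ Θ,
      ∫⁻ z, ENNReal.ofReal
          (⨆ θ : Θ, ‖fderivWithin ℝ (fun θ'' => Real.log (f z θ'')) Θ θ‖ ^ 2)
        ∂(densMeasure μ f θ') ≤ ENNReal.ofReal C)
    -- the identifiability of the family
    (hident : ∀ θ ∈ Θ, (fun z => f z θ) =ᵐ[μ] (fun z => f z θ₀) → θ = θ₀)
    -- the random bootstrap parameter, consistent for θ₀
    {Ω : Type*} [MeasurableSpace Ω] (P : Measure Ω) [IsProbabilityMeasure P]
    (θstar : ℕ → Ω → EuclideanSpace ℝ (Fin q))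
    (hθstarmeas : ∀ N, Measurable (θstar N))
    (hθstarmem : ∀ N ω, θstar N ω ∈ Θ)
    (hθstarcons : ∀ ε : ℝ, 0 < ε →
      Tendsto (fun N => P {ω | ε ≤ dist (θstar N ω) θ₀}) atTop (nhds 0))
    -- a measurable selection of bootstrap maximizers over Θ₀
    (θhatB : (N : ℕ) → (Fin N → (Fin J → ℝ)) → EuclideanSpace ℝ (Fin q))
    (hθhatBmeas : ∀ N, Measurable (θhatB N))
    (hθhatBmem : ∀ N ys, θhatB N ys ∈ Θ₀)
    (hθhatBmax : ∀ N ys, ∀ θ ∈ Θ₀,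
      ∑ i : Fin N, Real.log (f (ys i) θ) ≤
        ∑ i : Fin N, Real.log (f (ys i) (θhatB N ys))) :
    ∀ ε : ℝ, 0 < ε → ∀ η : ℝ, 0 < η →
      Tendsto (fun N =>
          P {ω | ENNReal.ofReal η <
            (bootLaw μ f N (θstar N ω)) {ys | ε < ‖θhatB N ys - θ₀‖}})
        atTop (nhds 0) := by
  intro ε hε η hη
  obtain ⟨C, hC⟩ := hmom0
  haveI : CompactSpace Θ := isCompact_iff_compactSpace.1 hΘcomp
  haveI hsf : ∀ x : Θ, SigmaFinite (μ.withDensity fun z => ENNReal.ofReal (f z (x : _))) :=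
    fun x => inferInstanceAs (SigmaFinite (densMeasure μ f x))
  have hcore := BootAux.core (X := Θ) μ (fun x z => f z x)
    (fun x => hmeas.comp (measurable_id.prodMk measurable_const))
    (fun x z => hpos z x x.2) (fun x => hprob x x.2)
    (fun z => continuousOn_iff_continuous_restrict.1 (hdiff z).continuousOn)
    ⟨θ₀, hΘ₀sub hθ₀⟩ C (fun x => hC x x.2)
    (fun x hx => Subtype.ext (hident x x.2 hx)) ε hε
  have hev := hcore.eventually_lt_const (ENNReal.ofReal_pos.2 hη)
  rw [eventually_prod_iff] at hev
  obtain ⟨pa, hpa, pb, hpb, hev⟩ := hev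
  obtain ⟨ρ, hρ, hball⟩ := Metric.eventually_nhds_iff.1 hpb
  refine tendsto_of_tendsto_of_tendsto_of_le_of_le' tendsto_const_nhds (hθstarcons ρ hρ)
    (Eventually.of_forall fun _ => zero_le) ?_
  filter_upwards [hpa] with N hN
  refine measure_mono fun ω hω => ?_
  show ρ ≤ dist (θstar N ω) θ₀
  by_contra! hlt
  have h2 := hev hN (hball (y := ⟨θstar N ω, hθstarmem N ω⟩) hlt)
  refine absurd hω (not_lt.2 (le_trans (measure_mono ?_) h2.le))
  intro ys hys
  refine ⟨⟨θhatB N ys, hΘ₀sub (hθhatBmem N ys)⟩, ?_, hθhatBmax N ys θ₀ hθ₀⟩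
  have : ε < ‖θhatB N ys - θ₀‖ := hys
  rw [← dist_eq_norm] at this
  exact this.le
end

section
/- Let Θ be a compact metric space, σ : Θ → [σ_min, σ_max] ⊂ (0, ∞), g : Θ × ℝ^p → ℝ^J jointly continuous, γ_p the standard Gaussian measure on ℝ^p, and define F(y;θ) = ∫_{ℝ^p} exp(−‖y − g(θ,ξ)‖²/(2σ(θ)²)) dγ_p(ξ) for y ∈ ℝ^J and θ ∈ Θ. Fix M > 0, let κ_M = γ_p({ξ : ‖ξ‖ ≤ M}) ∈ (0,1) and ᾱ_M = sup_{θ∈Θ} sup_{‖ξ‖≤M} ‖g(θ,ξ)‖ (finite by compactness). Then for every y ∈ ℝ^J and every θ ∈ Θ one has 0 < F(y;θ) ≤ 1 and |log F(y;θ)| ≤ −log κ_M + (‖y‖ + ᾱ_M)²/(2σ_min²). -/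
open MeasureTheory

/-- The standard Gaussian measure on `ℝ^p` (Euclidean space), defined as Lebesgue
measure weighted by the standard Gaussian density. -/
noncomputable def stdGaussian (p : ℕ) : Measure (EuclideanSpace ℝ (Fin p)) :=
  volume.withDensity fun ξ =>
    ENNReal.ofReal ((2 * Real.pi) ^ (-(p : ℝ) / 2) * Real.exp (-‖ξ‖ ^ 2 / 2))

/-!
Uniform envelope bound for the log of the unnormalized marginal likelihood
`F(y;θ) = ∫ exp(−‖y − g(θ,ξ)‖²/(2σ(θ)²)) dγ_p(ξ)` of a nonlinear mixed-effects model: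
for all `y` and `θ`, `0 < F(y;θ) ≤ 1` and
`|log F(y;θ)| ≤ −log κ_M + (‖y‖ + ᾱ_M)²/(2σ_min²)`,
with `κ_M = γ_p(‖ξ‖ ≤ M)` and `ᾱ_M = sup_{θ∈Θ} sup_{‖ξ‖≤M} ‖g(θ,ξ)‖`.
-/

theorem stdGaussian_isProb (p : ℕ) : IsProbabilityMeasure (stdGaussian p) := by
  have h1 : ∫ ξ : EuclideanSpace ℝ (Fin p), Real.exp (-‖ξ‖ ^ 2 / 2)
      = (2 * Real.pi) ^ ((p : ℝ) / 2) := by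
    have h := GaussianFourier.integral_rexp_neg_mul_sq_norm
      (V := EuclideanSpace ℝ (Fin p)) (b := 1 / 2) (by norm_num)
    rw [finrank_euclideanSpace_fin] at h
    have e : Real.pi / (1 / 2) = 2 * Real.pi := by ring
    rw [e] at h
    rw [← h]
    congr 1
    ext ξ
    congr 1
    ring
  have hpos : (0 : ℝ) < (2 * Real.pi) ^ ((p : ℝ) / 2) := by positivity
  have hint : Integrable (fun ξ : EuclideanSpace ℝ (Fin p) => Real.exp (-‖ξ‖ ^ 2 / 2)) := by
    by_contra hc
    rw [integral_undef hc] at h1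
    exact hpos.ne h1
  constructor
  rw [stdGaussian, withDensity_apply _ MeasurableSet.univ, Measure.restrict_univ,
    ← ofReal_integral_eq_lintegral_ofReal (hint.const_mul _)
      (Filter.Eventually.of_forall fun ξ => by positivity), integral_const_mul, h1,
    ← Real.rpow_add (by positivity)]
  have e : -(p : ℝ) / 2 + (p : ℝ) / 2 = 0 := by ring
  simp [e]

theorem stdGaussian_ball_pos (p : ℕ) (M : ℝ) (hM : 0 < M) :
    0 < stdGaussian p {ξ | ‖ξ‖ ≤ M} := by
  have hac : (volume : Measure (EuclideanSpace ℝ (Fin p))) ≪ stdGaussian p := by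
    apply withDensity_absolutelyContinuous'
    · fun_prop
    · refine Filter.Eventually.of_forall fun ξ => ?_
      rw [ne_eq, ENNReal.ofReal_eq_zero, not_le]
      positivity
  rw [pos_iff_ne_zero]
  intro h
  have h0 := hac h
  have : {ξ : EuclideanSpace ℝ (Fin p) | ‖ξ‖ ≤ M} = Metric.closedBall 0 M := by
    ext; simp
  rw [this] at h0
  exact (Metric.measure_closedBall_pos volume (0 : EuclideanSpace ℝ (Fin p)) hM).ne' h0

theorem stmt_9 {Θ : Type*} [MetricSpace Θ] [CompactSpace Θ]
    (p J : ℕ) (σmin σmax : ℝ) (hσmin : 0 < σmin) (hσminmax : σmin ≤ σmax)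
    (σ : Θ → ℝ) (hσ : ∀ θ, σ θ ∈ Set.Icc σmin σmax)
    (g : Θ → EuclideanSpace ℝ (Fin p) → EuclideanSpace ℝ (Fin J))
    (hg : Continuous fun q : Θ × EuclideanSpace ℝ (Fin p) => g q.1 q.2)
    (F : EuclideanSpace ℝ (Fin J) → Θ → ℝ)
    (hF : ∀ y θ, F y θ =
      ∫ ξ, Real.exp (-‖y - g θ ξ‖ ^ 2 / (2 * (σ θ) ^ 2)) ∂(stdGaussian p))
    (M : ℝ) (hM : 0 < M)
    (κM : ℝ) (hκM : κM = ((stdGaussian p) {ξ | ‖ξ‖ ≤ M}).toReal)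
    (αM : ℝ)
    (hαM : αM = sSup ((fun q : Θ × EuclideanSpace ℝ (Fin p) => ‖g q.1 q.2‖) ''
      (Set.univ ×ˢ {ξ | ‖ξ‖ ≤ M}))) :
    ∀ (y : EuclideanSpace ℝ (Fin J)) (θ : Θ),
      (0 < F y θ ∧ F y θ ≤ 1) ∧
      |Real.log (F y θ)| ≤ -Real.log κM + (‖y‖ + αM) ^ 2 / (2 * σmin ^ 2) := by
  intro y θ
  haveI := stdGaussian_isProb p
  have hσ0 : 0 < σ θ := lt_of_lt_of_le hσmin (hσ θ).1
  have hκ0 : 0 < κM := by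
    rw [hκM]
    exact ENNReal.toReal_pos (stdGaussian_ball_pos p M hM).ne' (measure_ne_top _ _)
  have hgc : Continuous (g θ) := hg.comp (by fun_prop : Continuous fun ξ => (θ, ξ))
  have hle1 : ∀ ξ, Real.exp (-‖y - g θ ξ‖ ^ 2 / (2 * (σ θ) ^ 2)) ≤ 1 := fun ξ => by
    rw [Real.exp_le_one_iff]
    exact div_nonpos_of_nonpos_of_nonneg (by simp) (by positivity)
  have hint : Integrable (fun ξ => Real.exp (-‖y - g θ ξ‖ ^ 2 / (2 * (σ θ) ^ 2)))
      (stdGaussian p) := by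
    refine Integrable.of_bound (C := 1) ?_ ?_
    · exact Continuous.aestronglyMeasurable (by fun_prop)
    · refine Filter.Eventually.of_forall fun ξ => ?_
      rw [Real.norm_of_nonneg (Real.exp_pos _).le]
      exact hle1 ξ
  have hset : {ξ : EuclideanSpace ℝ (Fin p) | ‖ξ‖ ≤ M} = Metric.closedBall 0 M := by
    ext; simp
  have hmeas : MeasurableSet {ξ : EuclideanSpace ℝ (Fin p) | ‖ξ‖ ≤ M} := by
    rw [hset]; exact measurableSet_closedBall
  have hbdd : BddAbove ((fun q : Θ × EuclideanSpace ℝ (Fin p) => ‖g q.1 q.2‖) ''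
      (Set.univ ×ˢ {ξ | ‖ξ‖ ≤ M})) := by
    rw [hset]
    exact ((isCompact_univ.prod (isCompact_closedBall _ _)).image hg.norm).bddAbove
  have hgα : ∀ ξ, ‖ξ‖ ≤ M → ‖g θ ξ‖ ≤ αM := fun ξ hξ => by
    rw [hαM]
    exact le_csSup hbdd ⟨(θ, ξ), ⟨Set.mem_univ _, hξ⟩, rfl⟩
  set B : ℝ := (‖y‖ + αM) ^ 2 / (2 * σmin ^ 2) with hB
  have hpt : ∀ ξ ∈ {ξ : EuclideanSpace ℝ (Fin p) | ‖ξ‖ ≤ M},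
      Real.exp (-B) ≤ Real.exp (-‖y - g θ ξ‖ ^ 2 / (2 * (σ θ) ^ 2)) := fun ξ hξ => by
    rw [Real.exp_le_exp, neg_div, neg_le_neg_iff]
    have h1 : ‖y - g θ ξ‖ ≤ ‖y‖ + αM := (norm_sub_le _ _).trans (by linarith [hgα ξ hξ])
    have h2 := (hσ θ).1
    rw [hB]
    gcongr
  have hlow : κM * Real.exp (-B) ≤ F y θ := by
    rw [hF]
    calc κM * Real.exp (-B)
        = ∫ _ξ in {ξ : EuclideanSpace ℝ (Fin p) | ‖ξ‖ ≤ M}, Real.exp (-B) ∂(stdGaussian p) := by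
          rw [setIntegral_const, smul_eq_mul, hκM]; rfl
      _ ≤ ∫ ξ in {ξ : EuclideanSpace ℝ (Fin p) | ‖ξ‖ ≤ M},
            Real.exp (-‖y - g θ ξ‖ ^ 2 / (2 * (σ θ) ^ 2)) ∂(stdGaussian p) :=
          setIntegral_mono_on (integrable_const _).integrableOn hint.integrableOn hmeas hpt
      _ ≤ _ := setIntegral_le_integral hint
          (Filter.Eventually.of_forall fun ξ => (Real.exp_pos _).le)
  have hup : F y θ ≤ 1 := by
    rw [hF]
    calc _ ≤ ∫ _ξ, (1 : ℝ) ∂(stdGaussian p) := integral_mono hint (integrable_const _) hle1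
      _ = 1 := by simp
  have hlowpos : 0 < κM * Real.exp (-B) := by positivity
  have hpos : 0 < F y θ := lt_of_lt_of_le hlowpos hlow
  refine ⟨⟨hpos, hup⟩, ?_⟩
  rw [abs_of_nonpos (Real.log_nonpos hpos.le hup)]
  have h := Real.log_le_log hlowpos hlow
  rw [Real.log_mul hκ0.ne' (Real.exp_pos _).ne', Real.log_exp] at h
  linarith
end
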